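/- arXiv:0804.1932 — 9 statements merged into one kernel-verified Lean document; each statement's English description precedes it below -/
import Mathlib

section
/- Let H be an n×n Hadamard matrix satisfying the group condition (GC). Then G(H,1) is an abelian group under the componentwise product: the all-ones row vector lies in G(H,1), G(H,1) is closed under componentwise product, and every element is its own inverse (u ∘ u equals the all-ones vector for every u ∈ G(H,1)). -/
open Matrix

/-- An `n × n` Hadamard matrix: entries in `{-1, 1}` and `H * Hᵀ = n • I`. -/
def IsHadamardMatrix {n : ℕ} (H : Matrix (Fin n) (Fin n) ℝ) : Prop :=
  (∀ i j, H i j = 1 ∨ H i j = -1) ∧ H * Hᵀ = (n : ℝ) • 1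

/-- `G(M, i)`: the set of rows multiplied componentwise with row `i`, together
with their negations. -/
def rowGroup {n : ℕ} (M : Matrix (Fin n) (Fin n) ℝ) (i : Fin n) : Set (Fin n → ℝ) :=
  {v | ∃ j : Fin n, v = M j * M i ∨ v = -(M j * M i)}

/-- The group condition (GC): `G(H, i) = G(H, 1)` and `G(Hᵀ, i) = G(Hᵀ, 1)` for all `i`. -/
def GroupCond {n : ℕ} (H : Matrix (Fin n) (Fin n) ℝ) : Prop :=
  (∀ i i₀ : Fin n, i₀.1 = 0 → rowGroup H i = rowGroup H i₀) ∧
  (∀ i i₀ : Fin n, i₀.1 = 0 → rowGroup Hᵀ i = rowGroup Hᵀ i₀)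

theorem stmt0 {n : ℕ} (hn : 0 < n) (H : Matrix (Fin n) (Fin n) ℝ)
    (hH : IsHadamardMatrix H) (hGC : GroupCond H) :
    (1 : Fin n → ℝ) ∈ rowGroup H ⟨0, hn⟩ ∧
    (∀ u v : Fin n → ℝ, u ∈ rowGroup H ⟨0, hn⟩ → v ∈ rowGroup H ⟨0, hn⟩ →
      u * v ∈ rowGroup H ⟨0, hn⟩) ∧
    (∀ u : Fin n → ℝ, u ∈ rowGroup H ⟨0, hn⟩ → u * u = 1) := by
  have hsq : ∀ i, H i * H i = 1 := fun i ↦ funext fun j ↦ by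
    rcases hH.1 i j with h | h <;> simp [h]
  refine ⟨⟨⟨0, hn⟩, Or.inl (hsq _).symm⟩, ?_, ?_⟩
  · rintro u v hu ⟨k, hv⟩
    rw [← hGC.1 k ⟨0, hn⟩ rfl] at hu
    obtain ⟨m, hu⟩ := hu
    have key : H m * H k * (H k * H ⟨0, hn⟩) = H m * H ⟨0, hn⟩ := by
      rw [mul_assoc, ← mul_assoc (H k), hsq, one_mul]
    refine ⟨m, ?_⟩
    rcases hu with rfl | rfl <;> rcases hv with rfl | rfl <;> simp [key]
  · rintro u ⟨j, rfl | rfl⟩ <;>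
      simp only [neg_mul_neg, mul_mul_mul_comm, hsq, one_mul]
end

section
/- Let H be an n×n Hadamard matrix satisfying the group condition (GC). Then n is a power of 2. -/
open Matrix

theorem IsHadamardMatrix.row_mul_self {n : ℕ} {H : Matrix (Fin n) (Fin n) ℝ}
    (hH : IsHadamardMatrix H) (i : Fin n) : H i * H i = 1 := by
  funext t
  rcases hH.1 i t with h | h <;> simp [h]

/-- The signed rows of a Hadamard matrix are pairwise distinct. -/
theorem IsHadamardMatrix.signed_row_injective {n : ℕ} {H : Matrix (Fin n) (Fin n) ℝ}
    (hH : IsHadamardMatrix H) (hn : 0 < n) {j k : Fin n} {a b : ℤˣ}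
    (h : ((a : ℤ) : ℝ) • H j = ((b : ℤ) : ℝ) • H k) : (j, a) = (k, b) := by
  have hdot : ∀ p q : Fin n, H p ⬝ᵥ H q = if p = q then (n : ℝ) else 0 := fun p q => by
    have := congrFun (congrFun hH.2 p) q
    rw [Matrix.mul_apply'] at this
    simpa [Matrix.one_apply] using this
  have hn' : (n : ℝ) ≠ 0 := by exact_mod_cast hn.ne'
  have hk := congrArg (fun v => v ⬝ᵥ H j) h
  simp only [smul_dotProduct, hdot, smul_eq_mul] at hk
  by_cases hjk : k = j
  · subst hjk
    simp only [if_true] at hk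
    have hab := mul_right_cancel₀ hn' hk
    rw [Int.cast_inj, Units.val_inj] at hab
    rw [hab]
  · simp [hjk, hn'] at hk

theorem mem_rowGroup_iff {n : ℕ} {M : Matrix (Fin n) (Fin n) ℝ} {i : Fin n} {v : Fin n → ℝ} :
    v ∈ rowGroup M i ↔ ∃ (j : Fin n) (a : ℤˣ), v = ((a : ℤ) : ℝ) • (M j * M i) := by
  refine ⟨?_, ?_⟩
  · rintro ⟨j, h | h⟩
    · exact ⟨j, 1, by simpa using h⟩
    · exact ⟨j, -1, by simpa using h⟩
  · rintro ⟨j, a, h⟩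
    rcases Int.units_eq_one_or a with rfl | rfl
    · exact ⟨j, Or.inl (by simpa using h)⟩
    · exact ⟨j, Or.inr (by simpa using h)⟩

theorem IsHadamardMatrix.mul_self_of_mem_rowGroup {n : ℕ} {H : Matrix (Fin n) (Fin n) ℝ}
    (hH : IsHadamardMatrix H) {i : Fin n} {v : Fin n → ℝ} (hv : v ∈ rowGroup H i) :
    v * v = 1 := by
  obtain ⟨j, h | h⟩ := hv <;>
  · rw [h]
    linear_combination (H i * H i) * hH.row_mul_self j + hH.row_mul_self i

theorem IsHadamardMatrix.mul_mem_rowGroup {n : ℕ} {H : Matrix (Fin n) (Fin n) ℝ}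
    (hH : IsHadamardMatrix H) {i : Fin n} (hG : ∀ k, rowGroup H k = rowGroup H i)
    {v w : Fin n → ℝ} (hv : v ∈ rowGroup H i) (hw : w ∈ rowGroup H i) :
    v * w ∈ rowGroup H i := by
  obtain ⟨j, a, rfl⟩ := mem_rowGroup_iff.1 hv
  obtain ⟨k, b, rfl⟩ := mem_rowGroup_iff.1 hw
  rw [← hG k]
  refine mem_rowGroup_iff.2 ⟨j, a * b, ?_⟩
  have hi : ∀ t, H i t * H i t = 1 := congrFun (hH.row_mul_self i)
  funext t
  simp only [Pi.mul_apply, Pi.smul_apply, smul_eq_mul, Units.val_mul, Int.cast_mul]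
  linear_combination ((a : ℤ) : ℝ) * ((b : ℤ) : ℝ) * H j t * H k t * hi t

/-- Under the group condition on rows, `G(H, i)` as a group of units. -/
def IsHadamardMatrix.rowSubgroup {n : ℕ} {H : Matrix (Fin n) (Fin n) ℝ}
    (hH : IsHadamardMatrix H) (i : Fin n) (hG : ∀ k, rowGroup H k = rowGroup H i) :
    Subgroup (Fin n → ℝ)ˣ where
  carrier := {u | (u : Fin n → ℝ) ∈ rowGroup H i}
  mul_mem' hu hv := hH.mul_mem_rowGroup hG hu hv
  one_mem' := ⟨i, Or.inl (hH.row_mul_self i).symm⟩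
  inv_mem' {u} hu := by
    have h : u⁻¹ = u := inv_eq_of_mul_eq_one_left (Units.ext (hH.mul_self_of_mem_rowGroup hu))
    rw [h]
    exact hu

theorem IsHadamardMatrix.card_rowSubgroup {n : ℕ} {H : Matrix (Fin n) (Fin n) ℝ}
    (hH : IsHadamardMatrix H) (hn : 0 < n) (i : Fin n)
    (hG : ∀ k, rowGroup H k = rowGroup H i) :
    Nat.card (hH.rowSubgroup i hG) = n * 2 := by
  have hmem (x : Fin n × ℤˣ) : ((x.2 : ℤ) : ℝ) • (H x.1 * H i) ∈ rowGroup H i :=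
    mem_rowGroup_iff.2 ⟨x.1, x.2, rfl⟩
  let f (x : Fin n × ℤˣ) : hH.rowSubgroup i hG :=
    ⟨⟨_, _, hH.mul_self_of_mem_rowGroup (hmem x), hH.mul_self_of_mem_rowGroup (hmem x)⟩, hmem x⟩
  have hf : Function.Bijective f := by
    refine ⟨fun x y hxy => ?_, fun u => ?_⟩
    · have h : ((x.2 : ℤ) : ℝ) • (H x.1 * H i) = ((y.2 : ℤ) : ℝ) • (H y.1 * H i) :=
        congrArg (fun u : hH.rowSubgroup i hG => ((u : (Fin n → ℝ)ˣ) : Fin n → ℝ)) hxy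
      have h' := congrArg (· * H i) h
      simp only [smul_mul_assoc, mul_assoc, hH.row_mul_self i, mul_one] at h'
      exact hH.signed_row_injective hn h'
    · obtain ⟨j, a, h⟩ := mem_rowGroup_iff.1 u.2
      exact ⟨(j, a), Subtype.ext (Units.ext h.symm)⟩
  rw [← Nat.card_eq_of_bijective f hf]
  simp

theorem stmt1 {n : ℕ} (hn : 0 < n) (H : Matrix (Fin n) (Fin n) ℝ)
    (hH : IsHadamardMatrix H) (hGC : GroupCond H) :
    ∃ k : ℕ, n = 2 ^ k := by
  have hG : ∀ k, rowGroup H k = rowGroup H ⟨0, hn⟩ := fun k => hGC.1 k ⟨0, hn⟩ rfl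
  have hcard := hH.card_rowSubgroup hn ⟨0, hn⟩ hG
  have : Finite (hH.rowSubgroup ⟨0, hn⟩ hG) := Nat.finite_of_card_ne_zero (by omega)
  have hp : IsPGroup 2 (hH.rowSubgroup ⟨0, hn⟩ hG) := fun u => ⟨1, by
    rw [pow_one, pow_two]
    exact Subtype.ext (Units.ext (hH.mul_self_of_mem_rowGroup u.2))⟩
  have : Fact (Nat.Prime 2) := ⟨Nat.prime_two⟩
  obtain ⟨k, -, hk⟩ := (Nat.dvd_prime_pow Nat.prime_two).1
    ((Dvd.intro 2 hcard.symm).trans (IsPGroup.iff_card.1 hp).choose_spec.dvd)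
  exact ⟨k, hk⟩
end

section
/- Let H be a normalised n×n Hadamard matrix such that G(H,1) is closed under the componentwise product. Then the set R(H) = {H_1,…,H_n} of rows of H is closed under the componentwise product: for all i, j ∈ [n] there exists ℓ ∈ [n] with H_i ∘ H_j = H_ℓ. -/
open Matrix

/-- `H` is normalised: first row and first column consist entirely of `+1`s. -/
def Normalised {n : ℕ} (H : Matrix (Fin n) (Fin n) ℝ) : Prop :=
  ∀ i j : Fin n, (i.1 = 0 → H i j = 1) ∧ (j.1 = 0 → H i j = 1)

theorem stmt2 {n : ℕ} (hn : 0 < n) (H : Matrix (Fin n) (Fin n) ℝ)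
    (hH : IsHadamardMatrix H) (hnorm : Normalised H)
    (hclosed : ∀ u v : Fin n → ℝ, u ∈ rowGroup H ⟨0, hn⟩ → v ∈ rowGroup H ⟨0, hn⟩ →
      u * v ∈ rowGroup H ⟨0, hn⟩) :
    ∀ i j : Fin n, ∃ l : Fin n, H i * H j = H l := by
  have h1 : H ⟨0, hn⟩ = 1 := funext fun j => (hnorm ⟨0, hn⟩ j).1 rfl
  have h0 : ∀ k, H k ⟨0, hn⟩ = 1 := fun k => (hnorm k ⟨0, hn⟩).2 rfl
  have hmem : ∀ k, H k ∈ rowGroup H ⟨0, hn⟩ := fun k => ⟨k, Or.inl (by rw [h1, mul_one])⟩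
  intro i j
  obtain ⟨l, hl | hl⟩ := hclosed _ _ (hmem i) (hmem j)
  · exact ⟨l, by rw [hl, h1, mul_one]⟩
  · have h := congrFun hl ⟨0, hn⟩
    simp only [Pi.mul_apply, Pi.neg_apply, h0] at h
    norm_num at h
end

section
/- Let B be an r×r matrix and C a t×t matrix, both with entries in {−1,+1}, and suppose the Kronecker (tensor) product H = B ⊗ C is a Hadamard matrix. Then B and C are Hadamard matrices. If H is symmetric then so are B and C. If moreover H and B are normalised and the set R(H) of rows of H is closed under the componentwise product, then C is normalised and both R(B) and R(C) are closed under the componentwise product. -/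
open Matrix

/-- The set of rows `R(H)` is closed under the componentwise product. -/
def RowClosed {n : ℕ} (H : Matrix (Fin n) (Fin n) ℝ) : Prop :=
  ∀ i j : Fin n, ∃ l : Fin n, H i * H j = H l

/-- Kronecker (tensor) product with explicit row-major indexing:
`(B ⊗ C)_{(k-1)t+i, (ℓ-1)u+j} = B_{k,ℓ} C_{i,j}`. -/
def kron {r t : ℕ} (B : Matrix (Fin r) (Fin r) ℝ) (C : Matrix (Fin t) (Fin t) ℝ) :
    Matrix (Fin (r * t)) (Fin (r * t)) ℝ :=
  fun i j => B i.divNat j.divNat * C i.modNat j.modNat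

theorem kron_finProdFinEquiv {r t : ℕ} (B : Matrix (Fin r) (Fin r) ℝ)
    (C : Matrix (Fin t) (Fin t) ℝ) (p q : Fin r × Fin t) :
    kron B C (finProdFinEquiv p) (finProdFinEquiv q) = B p.1 q.1 * C p.2 q.2 := by
  have h (x : Fin r × Fin t) :
      ((finProdFinEquiv x).divNat, (finProdFinEquiv x).modNat) = x :=
    finProdFinEquiv.symm_apply_apply x
  have h₁ (x : Fin r × Fin t) : (finProdFinEquiv x).divNat = x.1 := congrArg Prod.fst (h x)
  have h₂ (x : Fin r × Fin t) : (finProdFinEquiv x).modNat = x.2 := congrArg Prod.snd (h x)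
  simp only [kron, h₁, h₂]

theorem kron_mul_transpose_finProdFinEquiv {r t : ℕ} (B : Matrix (Fin r) (Fin r) ℝ)
    (C : Matrix (Fin t) (Fin t) ℝ) (p q : Fin r × Fin t) :
    (kron B C * (kron B C)ᵀ) (finProdFinEquiv p) (finProdFinEquiv q) =
      (B * Bᵀ) p.1 q.1 * (C * Cᵀ) p.2 q.2 := by
  simp only [Matrix.mul_apply, Matrix.transpose_apply]
  rw [← finProdFinEquiv.sum_comp, Finset.sum_mul_sum, Fintype.sum_prod_type]
  simp only [kron_finProdFinEquiv]
  exact Finset.sum_congr rfl fun _ _ => Finset.sum_congr rfl fun _ _ => by ring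

theorem mul_transpose_apply_self_of_sign {n : ℕ} {A : Matrix (Fin n) (Fin n) ℝ}
    (hA : ∀ i j, A i j = 1 ∨ A i j = -1) (i : Fin n) : (A * Aᵀ) i i = n := by
  have h (j : Fin n) : A i j * A i j = 1 := by rcases hA i j with h | h <;> simp [h]
  simp [Matrix.mul_apply, h]

theorem stmt3 {r t : ℕ} (hr : 0 < r) (ht : 0 < t)
    (B : Matrix (Fin r) (Fin r) ℝ) (C : Matrix (Fin t) (Fin t) ℝ)
    (hBent : ∀ i j, B i j = 1 ∨ B i j = -1)
    (hCent : ∀ i j, C i j = 1 ∨ C i j = -1)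
    (hH : IsHadamardMatrix (kron B C)) :
    IsHadamardMatrix B ∧ IsHadamardMatrix C ∧
    ((kron B C).IsSymm → B.IsSymm ∧ C.IsSymm) ∧
    (Normalised (kron B C) → Normalised B → RowClosed (kron B C) →
      Normalised C ∧ RowClosed B ∧ RowClosed C) := by
  have hr' : (r : ℝ) ≠ 0 := by positivity
  have ht' : (t : ℝ) ≠ 0 := by positivity
  let k₀ : Fin r := ⟨0, hr⟩
  let i₀ : Fin t := ⟨0, ht⟩
  have key (p q : Fin r × Fin t) :
      (B * Bᵀ) p.1 q.1 * (C * Cᵀ) p.2 q.2 = if p = q then (r : ℝ) * t else 0 := by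
    rw [← kron_mul_transpose_finProdFinEquiv, hH.2]
    simp [Matrix.one_apply]
  refine ⟨⟨hBent, ?_⟩, ⟨hCent, ?_⟩, fun hS => ⟨?_, ?_⟩, fun hN hBN hcl => ?_⟩
  · ext k l
    apply mul_right_cancel₀ ht'
    have h := key (k, i₀) (l, i₀)
    rw [mul_transpose_apply_self_of_sign hCent] at h
    rw [h]
    simp [Matrix.one_apply]
  · ext i j
    apply mul_left_cancel₀ hr'
    have h := key (k₀, i) (k₀, j)
    rw [mul_transpose_apply_self_of_sign hBent] at h
    rw [h]
    simp [Matrix.one_apply]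
  · ext k l
    have h := hS.apply (finProdFinEquiv (k, i₀)) (finProdFinEquiv (l, i₀))
    simp only [kron_finProdFinEquiv] at h
    exact mul_right_cancel₀ (by rcases hCent i₀ i₀ with h | h <;> simp [h]) h
  · ext i j
    have h := hS.apply (finProdFinEquiv (k₀, i)) (finProdFinEquiv (k₀, j))
    simp only [kron_finProdFinEquiv] at h
    exact mul_left_cancel₀ (by rcases hBent k₀ k₀ with h | h <;> simp [h]) h
  · have hB₀ (k : Fin r) : B k k₀ = 1 := (hBN k k₀).2 rfl
    have hCN : Normalised C := fun i j => by
      have hC : kron B C (finProdFinEquiv (k₀, i)) (finProdFinEquiv (k₀, j)) = C i j := by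
        simp [kron_finProdFinEquiv, hB₀]
      rw [← hC]
      exact ⟨fun h => (hN _ _).1 (by simp [k₀, h]), fun h => (hN _ _).2 (by simp [k₀, h])⟩
    have hC₀ (i : Fin t) : C i i₀ = 1 := (hCN i i₀).2 rfl
    have hprod (p q : Fin r × Fin t) : ∃ s : Fin r × Fin t, ∀ x : Fin r × Fin t,
        B p.1 x.1 * C p.2 x.2 * (B q.1 x.1 * C q.2 x.2) = B s.1 x.1 * C s.2 x.2 := by
      obtain ⟨l, hl⟩ := hcl (finProdFinEquiv p) (finProdFinEquiv q)
      obtain ⟨s, rfl⟩ := finProdFinEquiv.surjective l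
      refine ⟨s, fun x => ?_⟩
      simpa only [Pi.mul_apply, kron_finProdFinEquiv] using congrFun hl (finProdFinEquiv x)
    refine ⟨hCN, fun k l => ?_, fun i j => ?_⟩
    · obtain ⟨s, hs⟩ := hprod (k, i₀) (l, i₀)
      exact ⟨s.1, funext fun x => by simpa [hC₀] using hs (x, i₀)⟩
    · obtain ⟨s, hs⟩ := hprod (k₀, i) (k₀, j)
      exact ⟨s.2, funext fun y => by simpa [hB₀] using hs (k₀, y)⟩
end

section
/- Let H be a normalised n×n Hadamard matrix with n ≥ 2 satisfying the group condition (GC). Then there exist permutations Σ, Π of [n] with Σ(1) = Π(1) = 1 and a normalised (n/2)×(n/2) Hadamard matrix H′ satisfying (GC) such that H_{Σ,Π} = H₂ ⊗ H′, where H₂ is the 2×2 matrix with rows (1,1) and (1,−1). -/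
open Matrix

/-- The 2 × 2 Hadamard matrix `H₂`. -/
def H2 : Matrix (Fin 2) (Fin 2) ℝ := !![1, 1; 1, -1]

/-- Row products of a normalised sign matrix satisfying the row half of (GC) are again rows. -/
lemma exists_row_mul {n : ℕ} (hn : 0 < n) {M : Matrix (Fin n) (Fin n) ℝ} (hM : Normalised M)
    (hG : ∀ i i₀ : Fin n, i₀.1 = 0 → rowGroup M i = rowGroup M i₀) (i j : Fin n) :
    ∃ k : Fin n, ∀ x, M k x = M i x * M j x := by
  have hmem : M i * M j ∈ rowGroup M ⟨0, hn⟩ := by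
    rw [← hG j ⟨0, hn⟩ rfl]
    exact ⟨i, Or.inl rfl⟩
  obtain ⟨k, hk | hk⟩ := hmem
  · refine ⟨k, fun x => ?_⟩
    have h := congrFun hk x
    simp only [Pi.mul_apply, (hM ⟨0, hn⟩ x).1 rfl, mul_one] at h
    exact h.symm
  · have h := congrFun hk ⟨0, hn⟩
    simp only [Pi.mul_apply, Pi.neg_apply, (hM _ ⟨0, hn⟩).2 rfl] at h
    norm_num at h

/-- A sign matrix whose rows are closed under products satisfies the row half of (GC). -/
lemma rowGroup_eq_of_row_mul {n : ℕ} {M : Matrix (Fin n) (Fin n) ℝ}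
    (hsign : ∀ i j, M i j = 1 ∨ M i j = -1)
    (hmul : ∀ i j : Fin n, ∃ k : Fin n, ∀ x, M k x = M i x * M j x) (i i₀ : Fin n) :
    rowGroup M i = rowGroup M i₀ := by
  have hsub : ∀ a b : Fin n, rowGroup M a ⊆ rowGroup M b := by
    rintro a b v ⟨j, hj⟩
    obtain ⟨k, hk⟩ := hmul j a
    obtain ⟨l, hl⟩ := hmul k b
    have h : M l * M b = M j * M a := by
      funext x
      simp only [Pi.mul_apply, hl, hk]
      rcases hsign b x with h | h <;> simp [h]
    exact ⟨l, by rwa [h]⟩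
  exact (hsub i i₀).antisymm (hsub i₀ i)

/-- An involution exchanging a set with its complement splits `Fin n` into two halves
of equal size, where a given point of the set can be listed first. -/
lemma exists_halving_equiv {n : ℕ} (χ : Fin n → Prop) (t : Fin n → Fin n)
    (ht : Function.Involutive t) (hχ : ∀ i, χ (t i) ↔ ¬ χ i) (z : Fin n) (hz : χ z) :
    ∃ (m : ℕ) (s : Fin 2 × Fin m ≃ Fin n), n = 2 * m ∧ (∀ i, χ (s (0, i))) ∧
      (∀ i, s (1, i) = t (s (0, i))) ∧ (∀ i, i.1 = 0 → s (0, i) = z) ∧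
      ∀ x, χ x → ∃ i, s (0, i) = x := by
  classical
  set e₀ := (Fintype.equivFin {i // χ i}).symm with he₀
  have hm : 0 < Fintype.card {i // χ i} := Fintype.card_pos_iff.2 ⟨⟨z, hz⟩⟩
  set e := (Equiv.swap ⟨0, hm⟩ (e₀.symm ⟨z, hz⟩)).trans e₀ with he
  let f : Fin 2 × Fin (Fintype.card {i // χ i}) → Fin n :=
    fun p => if p.1 = 0 then (e p.2).1 else t (e p.2).1
  have hf0 : ∀ i, f (0, i) = (e i).1 := fun i => by simp [f]
  have hf1 : ∀ i, f (1, i) = t (e i).1 := fun i => by simp [f]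
  have hsurj : ∀ x, χ x → ∃ i, (e i).1 = x := fun x hx => ⟨e.symm ⟨x, hx⟩, by simp⟩
  have hbij : Function.Bijective f := by
    constructor
    · rintro ⟨k, i⟩ ⟨l, j⟩ h
      have hi := (e i).2
      have hj := (e j).2
      fin_cases k <;> fin_cases l <;>
        simp only [Fin.zero_eta, Fin.mk_one, hf0, hf1] at h
      · simp [e.injective (Subtype.ext h)]
      · rw [h, hχ] at hi
        exact absurd hj hi
      · rw [← h, hχ] at hj
        exact absurd hi hj
      · simp [e.injective (Subtype.ext (ht.injective h))]
    · intro x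
      by_cases hx : χ x
      · obtain ⟨i, hi⟩ := hsurj x hx
        exact ⟨(0, i), by rw [hf0, hi]⟩
      · obtain ⟨i, hi⟩ := hsurj (t x) ((hχ x).2 hx)
        exact ⟨(1, i), by rw [hf1, hi, ht]⟩
  refine ⟨_, Equiv.ofBijective f hbij, ?_, ?_, ?_, ?_, ?_⟩
  · simpa using (Fintype.card_congr (Equiv.ofBijective f hbij)).symm
  · intro i
    simpa [hf0] using (e i).2
  · intro i
    simp [hf0, hf1]
  · intro i hi
    have : i = ⟨0, hm⟩ := Fin.ext hi
    simp [hf0, this, he]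
  · simpa [hf0] using hsurj

/-- Entrywise form of the orthogonality of the rows of a Hadamard matrix. -/
lemma IsHadamardMatrix.sum_mul {n : ℕ} {H : Matrix (Fin n) (Fin n) ℝ} (hH : IsHadamardMatrix H)
    (i j : Fin n) : ∑ x, H i x * H j x = if i = j then (n : ℝ) else 0 := by
  have h := congrFun (congrFun hH.2 i) j
  simpa [Matrix.mul_apply, Matrix.one_apply] using h

/-- Distinct rows of a Hadamard matrix are different. -/
lemma IsHadamardMatrix.row_injective {n : ℕ} {H : Matrix (Fin n) (Fin n) ℝ}
    (hH : IsHadamardMatrix H) {i j : Fin n} (h : ∀ x, H i x = H j x) : i = j := by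
  by_contra hij
  have h1 := hH.sum_mul i j
  have h2 := hH.sum_mul i i
  simp only [← h, hij, if_false] at h1
  rw [h1, if_pos rfl] at h2
  have hn := i.pos
  have : (0 : ℝ) < n := by exact_mod_cast hn
  linarith

/-- The transpose of a Hadamard matrix is a Hadamard matrix. -/
lemma IsHadamardMatrix.transpose {n : ℕ} {H : Matrix (Fin n) (Fin n) ℝ}
    (hH : IsHadamardMatrix H) : IsHadamardMatrix Hᵀ := by
  refine ⟨fun i j => hH.1 j i, ?_⟩
  rcases Nat.eq_zero_or_pos n with rfl | hn
  · ext i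
    exact i.elim0
  have hn' : (n : ℝ) ≠ 0 := by exact_mod_cast hn.ne'
  have h : H * ((n : ℝ)⁻¹ • Hᵀ) = 1 := by
    rw [Matrix.mul_smul, hH.2, smul_smul, inv_mul_cancel₀ hn', one_smul]
  have h' := mul_eq_one_comm.1 h
  rw [Matrix.smul_mul] at h'
  rw [transpose_transpose, ← h', smul_smul, mul_inv_cancel₀ hn', one_smul]

/-- If row `r` has entry `-1` at column `c`, multiplication of rows by row `r` halves the
rows according to their entry at `c`. -/
lemma exists_row_halving {n : ℕ} {H : Matrix (Fin n) (Fin n) ℝ} (hH : IsHadamardMatrix H)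
    (hmul : ∀ i j : Fin n, ∃ k : Fin n, ∀ x, H k x = H i x * H j x)
    {r c z : Fin n} (hrc : H r c = -1) (hz : H z c = 1) :
    ∃ (m : ℕ) (s : Fin 2 × Fin m ≃ Fin n), n = 2 * m ∧ (∀ i, H (s (0, i)) c = 1) ∧
      (∀ i x, H (s (1, i)) x = H r x * H (s (0, i)) x) ∧ (∀ i, i.1 = 0 → s (0, i) = z) ∧
      ∀ x, H x c = 1 → ∃ i, s (0, i) = x := by
  choose t ht using hmul r
  have hinv : Function.Involutive t := fun i => hH.row_injective fun x => by
    rw [ht, ht]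
    rcases hH.1 r x with h | h <;> simp [h]
  obtain ⟨m, s, hm, h0, h1, hs, hsurj⟩ := exists_halving_equiv (fun i => H i c = 1) t hinv
    (fun i => by
      simp only [ht, hrc]
      rcases hH.1 i c with h | h <;> rw [h] <;> norm_num) z hz
  exact ⟨m, s, hm, h0, fun i x => by rw [h1, ht], hs, hsurj⟩

theorem stmt4 {n : ℕ} (hn : 2 ≤ n) (H : Matrix (Fin n) (Fin n) ℝ)
    (hH : IsHadamardMatrix H) (hnorm : Normalised H) (hGC : GroupCond H) :
    ∃ (σ π : Equiv.Perm (Fin n)) (m : ℕ) (hm : n = 2 * m)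
      (H' : Matrix (Fin m) (Fin m) ℝ),
      σ ⟨0, by omega⟩ = ⟨0, by omega⟩ ∧ π ⟨0, by omega⟩ = ⟨0, by omega⟩ ∧
      IsHadamardMatrix H' ∧ Normalised H' ∧ GroupCond H' ∧
      ∀ i j : Fin n, H (σ i) (π j) = kron H2 H' (Fin.cast hm i) (Fin.cast hm j) := by
  have hpos : 0 < n := by omega
  have hrow := exists_row_mul hpos hnorm hGC.1
  have hcol := exists_row_mul hpos (M := Hᵀ) (fun i j => (hnorm j i).symm) hGC.2
  obtain ⟨c, hrc⟩ : ∃ c, H ⟨1, hn⟩ c = -1 := by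
    by_contra! hne
    have h : (⟨1, hn⟩ : Fin n) = ⟨0, hpos⟩ := hH.row_injective fun x => by
      rw [(hnorm ⟨0, hpos⟩ x).1 rfl]
      exact (hH.1 _ x).resolve_right (hne x)
    simp at h
  obtain ⟨m, s, hm, hs0, hs1, hsz, hss⟩ :=
    exists_row_halving hH hrow hrc ((hnorm ⟨0, hpos⟩ c).1 rfl)
  obtain ⟨m', u, hm', hu0, hu1, huz, hus⟩ :=
    exists_row_halving hH.transpose hcol (r := c) (c := ⟨1, hn⟩) hrc
      ((hnorm ⟨1, hn⟩ ⟨0, hpos⟩).2 rfl)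
  obtain rfl : m = m' := by omega
  simp only [transpose_apply] at hu0 hu1 hus
  have hmpos : 0 < m := by omega
  let H' : Matrix (Fin m) (Fin m) ℝ := fun i j => H (s (0, i)) (u (0, j))
  have hsign : ∀ i j, H' i j = 1 ∨ H' i j = -1 := fun i j => hH.1 _ _
  refine ⟨(finCongr hm).trans (finProdFinEquiv.symm.trans s),
    (finCongr hm).trans (finProdFinEquiv.symm.trans u), m, hm, H', ?_, ?_, ⟨hsign, ?_⟩, ?_,
    ⟨fun i i₀ _ => rowGroup_eq_of_row_mul hsign ?_ i i₀,
      fun i i₀ _ => rowGroup_eq_of_row_mul (fun i j => hsign j i) ?_ i i₀⟩, ?_⟩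
  · have h : finProdFinEquiv.symm (finCongr hm ⟨0, hpos⟩) = ((0, ⟨0, hmpos⟩) : Fin 2 × Fin m) := by
      rw [Equiv.symm_apply_eq]
      ext
      simp
    simp only [Equiv.trans_apply, h]
    exact hsz _ rfl
  · have h : finProdFinEquiv.symm (finCongr hm ⟨0, hpos⟩) = ((0, ⟨0, hmpos⟩) : Fin 2 × Fin m) := by
      rw [Equiv.symm_apply_eq]
      ext
      simp
    simp only [Equiv.trans_apply, h]
    exact huz _ rfl
  · ext i j
    have h := hH.sum_mul (s (0, i)) (s (0, j))
    rw [← u.sum_comp, Fintype.sum_prod_type, Fin.sum_univ_two] at h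
    simp only [hu1, hs0, one_mul, s.injective.eq_iff, Prod.mk.injEq, true_and] at h
    have hn2 : (n : ℝ) = 2 * m := by exact_mod_cast hm
    have hentry : ∀ a b, H' a b = H (s (0, a)) (u (0, b)) := fun _ _ => rfl
    simp only [Matrix.mul_apply, transpose_apply, Matrix.smul_apply, Matrix.one_apply, hentry,
      smul_eq_mul, mul_ite, mul_one, mul_zero]
    split_ifs at h ⊢ <;> linarith
  · exact fun i j => ⟨fun hi => by simp only [H', hsz i hi]; exact (hnorm _ _).1 rfl,
      fun hj => by simp only [H', huz j hj]; exact (hnorm _ _).2 rfl⟩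
  · intro i j
    obtain ⟨k, hk⟩ := hrow (s (0, i)) (s (0, j))
    obtain ⟨l, rfl⟩ := hss k (by rw [hk, hs0, hs0, one_mul])
    exact ⟨l, fun x => hk _⟩
  · intro i j
    obtain ⟨k, hk⟩ := hcol (u (0, i)) (u (0, j))
    simp only [transpose_apply] at hk
    obtain ⟨l, rfl⟩ := hus k (by rw [hk, hu0, hu0, one_mul])
    exact ⟨l, fun x => hk _⟩
  · intro i j
    have key : ∀ (k l : Fin 2) (a b : Fin m), H (s (k, a)) (u (l, b)) = H2 k l * H' a b := by
      intro k l a b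
      fin_cases k <;> fin_cases l <;> simp [H2, H', hs1, hu1, hs0, hu0, hrc]
    exact key _ _ _ _
end

section
/- Let C be a symmetric m×m real matrix and let Δ⁺ and Δ⁻ be diagonal m×m real matrices. Let D = Δ⁺ + Δ⁻ and O = Δ⁺ − Δ⁻, let A be the 2m×2m matrix given in block form by A = [[C, −C], [−C, C]], and let Δ be the 2m×2m diagonal matrix whose upper-left m×m block is Δ⁺ and whose lower-right m×m block is Δ⁻. Then Z_{C,D,O}(G) = Z_{A,Δ}(G) for every graph G. -/
open Matrix

/-- A finite graph, possibly with loops and parallel edges: a finite vertex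
set, a finite edge set, and each edge has two (ordered, but orientation is
irrelevant for symmetric matrices) endpoints. -/
structure MGraph where
  nV : ℕ
  nE : ℕ
  src : Fin nE → Fin nV
  tgt : Fin nE → Fin nV

/-- The degree of a vertex; a loop contributes 2. -/
def MGraph.deg (G : MGraph) (v : Fin G.nV) : ℕ :=
  (Finset.univ.filter fun e => G.src e = v).card +
    (Finset.univ.filter fun e => G.tgt e = v).card

/-- The vertex-weighted partition function `Z_{A,D}(G)`. -/
def Zpart {S : Type} [Fintype S] (A D : Matrix S S ℝ) (G : MGraph) : ℝ :=
  ∑ ξ : Fin G.nV → S,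
    (∏ e : Fin G.nE, A (ξ (G.src e)) (ξ (G.tgt e))) * ∏ v : Fin G.nV, D (ξ v) (ξ v)

/-- The parity-distinguishing partition function `Z_{A,D,O}(G)`. -/
def Zpdpf {S : Type} [Fintype S] (A D O : Matrix S S ℝ) (G : MGraph) : ℝ :=
  ∑ ξ : Fin G.nV → S,
    (∏ e : Fin G.nE, A (ξ (G.src e)) (ξ (G.tgt e))) *
      ∏ v : Fin G.nV, if Even (G.deg v) then D (ξ v) (ξ v) else O (ξ v) (ξ v)

/-- A product over all edge endpoints collects each vertex as often as its degree. -/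
theorem MGraph.prod_endpoints {R : Type*} [CommMonoid R] (G : MGraph) (f : Fin G.nV → R) :
    ∏ e, f (G.src e) * f (G.tgt e) = ∏ v, f v ^ G.deg v := by
  have h (g : Fin G.nE → Fin G.nV) :
      ∏ e, f (g e) = ∏ v, f v ^ (Finset.univ.filter fun e => g e = v).card := by
    rw [← Finset.prod_fiberwise Finset.univ g]
    refine Finset.prod_congr rfl fun v _ => ?_
    rw [Finset.prod_congr rfl fun e he => by rw [(Finset.mem_filter.mp he).2], Finset.prod_const]
  simp only [MGraph.deg, pow_add, Finset.prod_mul_distrib, h]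

theorem fromBlocks_neg_apply_boolProdEquivSum {S : Type*} (C : Matrix S S ℝ) (a b : Bool × S) :
    fromBlocks C (-C) (-C) C (Equiv.boolProdEquivSum S a) (Equiv.boolProdEquivSum S b) =
      (cond a.1 (-1) 1 * cond b.1 (-1) 1) * C a.2 b.2 := by
  rcases a with ⟨_ | _, a⟩ <;> rcases b with ⟨_ | _, b⟩ <;> simp [Equiv.boolProdEquivSum]

theorem fromBlocks_diag_apply_boolProdEquivSum {S : Type*} (P M : Matrix S S ℝ) (a : Bool × S) :
    fromBlocks P 0 0 M (Equiv.boolProdEquivSum S a) (Equiv.boolProdEquivSum S a) =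
      cond a.1 (M a.2 a.2) (P a.2 a.2) := by
  rcases a with ⟨_ | _, a⟩ <;> simp [Equiv.boolProdEquivSum]

theorem stmt12 {m : ℕ} (C Δp Δm : Matrix (Fin m) (Fin m) ℝ) (hC : C.IsSymm)
    (hΔp : Δp.IsDiag) (hΔm : Δm.IsDiag) (G : MGraph) :
    Zpdpf C (Δp + Δm) (Δp - Δm) G =
      Zpart (Matrix.fromBlocks C (-C) (-C) C) (Matrix.fromBlocks Δp 0 0 Δm) G := by
  unfold Zpdpf Zpart
  rw [← ((Equiv.arrowProdEquivProdArrow (Fin G.nV) (fun _ => Bool) (fun _ => Fin m)).symm.trans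
    ((Equiv.refl (Fin G.nV)).arrowCongr (Equiv.boolProdEquivSum (Fin m)))).sum_comp,
    Fintype.sum_prod_type_right]
  refine Finset.sum_congr rfl fun ξ _ => ?_
  simp only [Equiv.trans_apply, Equiv.arrowCongr_apply, Equiv.arrowProdEquivProdArrow,
    Equiv.coe_fn_symm_mk, Function.comp_apply, Equiv.refl_symm, Equiv.refl_apply,
    fromBlocks_neg_apply_boolProdEquivSum, fromBlocks_diag_apply_boolProdEquivSum]
  have h (η : Fin G.nV → Bool) :
      ∏ e, (cond (η (G.src e)) (-1) 1 * cond (η (G.tgt e)) (-1) 1 : ℝ) =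
        ∏ v, (cond (η v) (-1) 1 : ℝ) ^ G.deg v :=
    G.prod_endpoints fun v => cond (η v) (-1) 1
  simp_rw [Finset.prod_mul_distrib (g := fun e => C (ξ (G.src e)) (ξ (G.tgt e))), h,
    mul_right_comm _ (∏ e, C (ξ (G.src e)) (ξ (G.tgt e))), ← Finset.prod_mul_distrib]
  rw [← Finset.sum_mul, mul_comm]
  congr 1
  rw [← Fintype.prod_sum fun v (b : Bool) =>
    (cond b (-1) 1 : ℝ) ^ G.deg v * cond b (Δm (ξ v) (ξ v)) (Δp (ξ v) (ξ v))]
  refine Finset.prod_congr rfl fun v _ => ?_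
  rw [Fintype.sum_bool]
  split_ifs with hv
  · simp [hv.neg_one_pow, add_comm]
  · simp [(Nat.not_even_iff_odd.mp hv).neg_one_pow, sub_eq_neg_add]
end

section
/- (Twin Reduction) Let A be a symmetric m×m real matrix and D a diagonal m×m real matrix. Suppose there are a map τ : [m] → [n] and a symmetric n×n real matrix B such that A_{μ,ν} = B_{τ(μ),τ(ν)} for all μ, ν ∈ [m]. Let Δ be the n×n diagonal matrix with Δ_{j,j} = ∑_{ν ∈ [m], τ(ν)=j} D_{ν,ν}. Then Z_{A,D}(G) = Z_{B,Δ}(G) for every graph G. -/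
open Matrix

theorem stmt13 {m n : ℕ} (A D : Matrix (Fin m) (Fin m) ℝ)
    (hA : A.IsSymm) (hD : D.IsDiag)
    (τ : Fin m → Fin n) (B : Matrix (Fin n) (Fin n) ℝ) (hB : B.IsSymm)
    (hAB : ∀ μ ν : Fin m, A μ ν = B (τ μ) (τ ν)) (G : MGraph) :
    Zpart A D G =
      Zpart B
        (Matrix.diagonal fun j : Fin n =>
          ∑ ν ∈ Finset.univ.filter fun ν : Fin m => τ ν = j, D ν ν) G := by
  simp only [Zpart, Matrix.diagonal_apply_eq, Finset.prod_univ_sum, Finset.mul_sum]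
  rw [← Finset.sum_fiberwise Finset.univ (fun ξ : Fin G.nV → Fin m => τ ∘ ξ)]
  refine Finset.sum_congr rfl fun η _ => Finset.sum_congr ?_ fun ξ hξ => ?_
  · ext ξ
    simp [Fintype.mem_piFinset, funext_iff]
  · simp only [Fintype.mem_piFinset, Finset.mem_filter, Finset.mem_univ, true_and] at hξ
    simp only [hAB, hξ]
end

section
/- (Extended Twin Reduction) Let A be a symmetric m×m real matrix and Δ a diagonal m×m real matrix. Suppose there are a map τ : [m] → [k], a sign map s : [m] → {−1,+1}, and a symmetric k×k real matrix B such that A_{μ,ν} = s(μ)·s(ν)·B_{τ(μ),τ(ν)} for all μ, ν ∈ [m]. Define diagonal k×k matrices D and O by D_{i,i} = ∑_{ν ∈ [m], τ(ν)=i} Δ_{ν,ν} and O_{i,i} = ∑_{ν ∈ [m], τ(ν)=i} s(ν)·Δ_{ν,ν}. Then Z_{A,Δ}(G) = Z_{B,D,O}(G) for every graph G. -/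
open Matrix

/-- A product of vertex values over all edge ends collects one factor per unit of degree. -/
theorem MGraph.prod_src_mul_prod_tgt {M : Type*} [CommMonoid M] (G : MGraph)
    (f : Fin G.nV → M) :
    (∏ e, f (G.src e)) * ∏ e, f (G.tgt e) = ∏ v, f v ^ G.deg v := by
  have h (g : Fin G.nE → Fin G.nV) :
      ∏ e, f (g e) = ∏ v, f v ^ (Finset.univ.filter fun e => g e = v).card := by
    rw [← Finset.prod_fiberwise Finset.univ g]
    refine Finset.prod_congr rfl fun v _ => Finset.prod_eq_pow_card fun e he => ?_
    rw [(Finset.mem_filter.mp he).2]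
  simp only [h, MGraph.deg, pow_add, Finset.prod_mul_distrib]

theorem stmt14 {m k : ℕ} (A Δ : Matrix (Fin m) (Fin m) ℝ)
    (hA : A.IsSymm) (hΔ : Δ.IsDiag)
    (τ : Fin m → Fin k) (s : Fin m → ℝ) (hs : ∀ ν, s ν = 1 ∨ s ν = -1)
    (B : Matrix (Fin k) (Fin k) ℝ) (hB : B.IsSymm)
    (hAB : ∀ μ ν : Fin m, A μ ν = s μ * s ν * B (τ μ) (τ ν)) (G : MGraph) :
    Zpart A Δ G =
      Zpdpf B
        (Matrix.diagonal fun i : Fin k =>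
          ∑ ν ∈ Finset.univ.filter fun ν : Fin m => τ ν = i, Δ ν ν)
        (Matrix.diagonal fun i : Fin k =>
          ∑ ν ∈ Finset.univ.filter fun ν : Fin m => τ ν = i, s ν * Δ ν ν) G := by
  have hpow (n : ℕ) (ν : Fin m) : s ν ^ n = if Even n then 1 else s ν := by
    rcases hs ν with h | h <;> split_ifs with hn
    · simp [h]
    · simp [h]
    · rw [h, hn.neg_one_pow]
    · rw [h, (Nat.not_even_iff_odd.mp hn).neg_one_pow]
  have hweight (ζ : Fin G.nV → Fin k) (v : Fin G.nV) :
      (if Even (G.deg v) then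
          ∑ ν ∈ Finset.univ.filter fun ν : Fin m => τ ν = ζ v, Δ ν ν
        else ∑ ν ∈ Finset.univ.filter fun ν : Fin m => τ ν = ζ v, s ν * Δ ν ν) =
      ∑ ν ∈ Finset.univ.filter fun ν : Fin m => τ ν = ζ v, s ν ^ G.deg v * Δ ν ν := by
    simp only [hpow]
    split_ifs <;> simp
  unfold Zpart Zpdpf
  simp only [Matrix.diagonal_apply_eq, hweight, Finset.prod_univ_sum, Finset.mul_sum]
  rw [← Finset.sum_fiberwise Finset.univ fun ξ : Fin G.nV → Fin m => τ ∘ ξ]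
  refine Finset.sum_congr rfl fun ζ _ => Finset.sum_congr ?_ fun ξ hξ => ?_
  · ext ξ
    simp [Fintype.mem_piFinset, funext_iff]
  · have hζ : ∀ v, τ (ξ v) = ζ v := by
      simpa [Fintype.mem_piFinset] using hξ
    simp only [hAB, hζ, Finset.prod_mul_distrib, ← G.prod_src_mul_prod_tgt fun v => s (ξ v)]
    ring
end

section
/- (Row-Column Negation) Let C be a symmetric m×m real matrix, let D and O be diagonal m×m real matrices, and fix i ∈ [m]. Let C′ be the matrix obtained from C by multiplying row i and column i by −1 (so C′_{a,b} = −C_{a,b} if exactly one of a, b equals i, and C′_{a,b} = C_{a,b} otherwise), and let O′ be obtained from O by negating the single entry O_{i,i}. Then Z_{C,D,O}(G) = Z_{C′,D,O′}(G) for every graph G. -/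
open Matrix

/-- The handshake identity: a product over edges of vertex weights at both endpoints collects
each vertex weight to the power of its degree. -/
theorem MGraph.prod_src_mul_tgt {M : Type*} [CommMonoid M] (G : MGraph) (f : Fin G.nV → M) :
    ∏ e, f (G.src e) * f (G.tgt e) = ∏ v, f v ^ G.deg v := by
  have fiber (g : Fin G.nE → Fin G.nV) :
      ∏ e, f (g e) = ∏ v, f v ^ (Finset.univ.filter fun e => g e = v).card := by
    rw [← Finset.prod_fiberwise' Finset.univ g f]
    simp [Finset.prod_const]
  simp only [Finset.prod_mul_distrib, fiber, MGraph.deg, pow_add]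

theorem stmt15 {m : ℕ} (C D O : Matrix (Fin m) (Fin m) ℝ)
    (hC : C.IsSymm) (hD : D.IsDiag) (hO : O.IsDiag) (i : Fin m) (G : MGraph) :
    Zpdpf C D O G =
      Zpdpf
        (fun a b : Fin m =>
          if (a = i ∧ b ≠ i) ∨ (a ≠ i ∧ b = i) then -C a b else C a b)
        D
        (fun a b : Fin m => if a = i ∧ b = i then -O a b else O a b) G := by
  let s : Fin m → ℝ := fun a => if a = i then -1 else 1
  have s_mul_self (a : Fin m) : s a * s a = 1 := by
    by_cases h : a = i <;> simp [s, h]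
  have edge_sign (a b : Fin m) :
      (if (a = i ∧ b ≠ i) ∨ (a ≠ i ∧ b = i) then -C a b else C a b) = s a * s b * C a b := by
    by_cases ha : a = i <;> by_cases hb : b = i <;> simp [s, ha, hb]
  have vertex_sign (a : Fin m) :
      (if a = i ∧ a = i then -O a a else O a a) = s a * O a a := by
    by_cases ha : a = i <;> simp [s, ha]
  unfold Zpdpf
  refine Finset.sum_congr rfl fun ξ _ => ?_
  simp only [edge_sign, vertex_sign]
  rw [Finset.prod_mul_distrib, G.prod_src_mul_tgt fun v => s (ξ v),
    mul_comm (∏ v, s (ξ v) ^ G.deg v), mul_assoc, ← Finset.prod_mul_distrib]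
  congr 1
  refine Finset.prod_congr rfl fun v _ => ?_
  split_ifs with h
  · obtain ⟨k, hk⟩ := h
    rw [hk, pow_add, ← mul_pow, s_mul_self, one_pow, one_mul]
  · obtain ⟨k, hk⟩ := Nat.not_even_iff_odd.mp h
    rw [hk, pow_succ, pow_mul, sq, s_mul_self, one_pow, one_mul, ← mul_assoc, s_mul_self, one_mul]
end
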